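/- arXiv:0810.3127 — 2 statements merged into one kernel-verified Lean document; each statement's English description precedes it below -/
import Mathlib

section
/- Let X be a normal Hausdorff topological space, A a closed subset of X such that A (with the subspace topology) is perfectly normal, and T : A → [0,1] an upper semicontinuous set-valued map whose values are nonempty closed convex subsets of [0,1]. Then there exists an upper semicontinuous set-valued map T̃ : X → [0,1] with nonempty closed convex values such that T̃(a) = T(a) for every a ∈ A. -/
/-- A set-valued map `T` is upper semicontinuous at `x₀`. -/
def SetValuedUscAt {X : Type*} [TopologicalSpace X] (T : X → Set ℝ) (x₀ : X) : Prop :=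
  ∀ V : Set ℝ, IsOpen V → T x₀ ⊆ V → ∃ U : Set X, IsOpen U ∧ x₀ ∈ U ∧ ∀ x ∈ U, T x ⊆ V

/-- A set-valued map is upper semicontinuous if it is so at every point. -/
def SetValuedUsc {X : Type*} [TopologicalSpace X] (T : X → Set ℝ) : Prop :=
  ∀ x, SetValuedUscAt T x

open Set in
/-- On a perfectly normal space, every lower semicontinuous function into `[0, 1]` is the pointwise
supremum of a sequence of continuous functions into `[0, 1]`. -/
theorem LowerSemicontinuous.exists_seq_continuous_isLUB {Y : Type*} [TopologicalSpace Y]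
    [PerfectlyNormalSpace Y] {f : Y → ℝ} (hf : LowerSemicontinuous f)
    (hf01 : ∀ y, f y ∈ Icc (0 : ℝ) 1) :
    ∃ F : ℕ → C(Y, ℝ), (∀ n y, F n y ∈ Icc (0 : ℝ) 1) ∧
      ∀ y, IsLUB (range fun n => F n y) (f y) := by
  choose u hu hu01 using fun q : ℚ => perfectlyNormalSpace_iff_forall_isClosed_preimage_zero.1
    ‹_› {y | f y ≤ q} (hf.isClosed_preimage (q : ℝ))
  have hu_iff (q : ℚ) (y : Y) : f y ≤ q ↔ u q y = 0 := Set.ext_iff.1 (hu q) y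
  let r (q : ℚ) : ℝ := max 0 (min 1 (q : ℝ))
  have hr (q : ℚ) : 0 ≤ r q ∧ r q ≤ 1 := ⟨le_max_left _ _, by simp [r]⟩
  let Φ (p : ℚ × ℕ) : C(Y, ℝ) :=
    ⟨fun y => r p.1 * min 1 (p.2 * u p.1 y), by fun_prop⟩
  have hΦ (p : ℚ × ℕ) (y : Y) : Φ p y = r p.1 * min 1 (p.2 * u p.1 y) := rfl
  have hmin (p : ℚ × ℕ) (y : Y) : 0 ≤ min 1 (p.2 * u p.1 y) :=
    le_min zero_le_one (mul_nonneg p.2.cast_nonneg (hu01 _ y).1)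
  have hle (p : ℚ × ℕ) (y : Y) : Φ p y ≤ r p.1 :=
    mul_le_of_le_one_right (hr p.1).1 (min_le_left _ _)
  obtain ⟨e, he⟩ := exists_surjective_nat (ℚ × ℕ)
  refine ⟨fun n => Φ (e n),
    fun n y => ⟨mul_nonneg (hr _).1 (hmin _ y), (hle _ y).trans (hr _).2⟩, fun y => ?_⟩
  change IsLUB (range ((fun p => Φ p y) ∘ e)) (f y)
  rw [he.range_comp]
  refine ⟨?_, fun b hb => ?_⟩
  · rintro _ ⟨p, rfl⟩
    rcases le_or_gt (f y) p.1 with h | h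
    · simpa [hΦ, (hu_iff p.1 y).1 h] using (hf01 y).1
    · exact (hle p y).trans (max_le (hf01 y).1 ((min_le_right _ _).trans h.le))
  · by_contra! hlt
    obtain ⟨q, hbq, hqf⟩ := exists_rat_btwn hlt
    have hpos : 0 < u q y :=
      lt_of_le_of_ne (hu01 q y).1 fun h => hqf.not_ge ((hu_iff q y).2 h.symm)
    obtain ⟨n, hn⟩ := exists_nat_ge (1 / u q y)
    have h1 : 1 ≤ n * u q y := (div_le_iff₀ hpos).1 hn
    have h2 : Φ (q, n) y ≤ b := hb ⟨(q, n), rfl⟩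
    rw [hΦ, min_eq_left h1, mul_one] at h2
    have h3 : (q : ℝ) ≤ r q := by
      rw [show r q = max 0 (min 1 (q : ℝ)) from rfl, min_eq_right (hqf.le.trans (hf01 y).2)]
      exact le_max_right _ _
    linarith

open Set in
/-- A lower semicontinuous function into `[0, 1]` on a closed, perfectly normal subset of a normal
space is a pointwise supremum of restrictions of continuous functions on the whole space. -/
theorem LowerSemicontinuous.exists_seq_continuous_isLUB_of_isClosed {X : Type*}
    [TopologicalSpace X] [NormalSpace X] {A : Set X} (hA : IsClosed A) [PerfectlyNormalSpace A]
    {f : A → ℝ} (hf : LowerSemicontinuous f) (hf01 : ∀ a, f a ∈ Icc (0 : ℝ) 1) :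
    ∃ F : ℕ → C(X, ℝ), (∀ n x, F n x ∈ Icc (0 : ℝ) 1) ∧
      ∀ a : A, IsLUB (range fun n => F n a) (f a) := by
  obtain ⟨F, hF01, hF⟩ := hf.exists_seq_continuous_isLUB hf01
  choose G hG01 hG using fun n =>
    (F n).exists_restrict_eq_forall_mem_of_closed (hF01 n) (nonempty_Icc.2 zero_le_one) hA
  refine ⟨G, hG01, fun a => ?_⟩
  convert hF a using 4 with n
  exact DFunLike.congr_fun (hG n) a

open Set in
/-- Two sequences of continuous functions into `[0, 1]` can be corrected to a lower semicontinuous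
function below an upper semicontinuous one, without changing their supremum and infimum at the
points where these are already in order. -/
theorem exists_lowerSemicontinuous_le_upperSemicontinuous {X : Type*} [TopologicalSpace X]
    {F G : ℕ → C(X, ℝ)} (hF : ∀ n x, F n x ∈ Icc (0 : ℝ) 1) (hG : ∀ n x, G n x ∈ Icc (0 : ℝ) 1) :
    ∃ f g : X → ℝ, LowerSemicontinuous f ∧ UpperSemicontinuous g ∧ (∀ x, f x ≤ g x) ∧
      (∀ x, 0 ≤ f x) ∧ (∀ x, g x ≤ 1) ∧
      ∀ x, (∀ m n, F m x ≤ G n x) → f x = ⨆ n, F n x ∧ g x = ⨅ n, G n x := by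
  have hne (n : ℕ) : (Finset.range (n + 1)).Nonempty := ⟨0, by simp⟩
  let F' (n : ℕ) (x : X) : ℝ := min (F n x) ((Finset.range (n + 1)).inf' (hne n) fun k => G k x)
  let G' (n : ℕ) (x : X) : ℝ := max (G n x) ((Finset.range (n + 1)).sup' (hne n) fun k => F k x)
  have hF' (n : ℕ) : Continuous (F' n) := by fun_prop
  have hG' (n : ℕ) : Continuous (G' n) := by fun_prop
  have hFG (x : X) (n m : ℕ) : F' n x ≤ G' m x := by
    rcases le_total n m with h | h
    · exact (min_le_left _ _).trans
        ((Finset.le_sup' (fun k => F k x) (by simp; omega)).trans (le_max_right _ _))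
    · exact (min_le_right _ _).trans
        ((Finset.inf'_le (fun k => G k x) (by simp; omega)).trans (le_max_left _ _))
  have hbdd (x : X) : BddAbove (range fun n => F' n x) :=
    ⟨G' 0 x, forall_mem_range.2 fun n => hFG x n 0⟩
  have hbdd' (x : X) : BddBelow (range fun n => G' n x) :=
    ⟨F' 0 x, forall_mem_range.2 fun n => hFG x 0 n⟩
  refine ⟨fun x => ⨆ n, F' n x, fun x => ⨅ n, G' n x,
    lowerSemicontinuous_ciSup hbdd fun n => (hF' n).lowerSemicontinuous,
    upperSemicontinuous_ciInf hbdd' fun n => (hG' n).upperSemicontinuous,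
    fun x => ciSup_le fun n => le_ciInf fun m => hFG x n m,
    fun x => le_ciSup_of_le (hbdd x) 0 ?_, fun x => ciInf_le_of_le (hbdd' x) 0 ?_,
    fun x h => ⟨?_, ?_⟩⟩
  · exact le_min (hF 0 x).1 (Finset.le_inf' _ _ fun k _ => (hG k x).1)
  · exact max_le (hG 0 x).2 (Finset.sup'_le _ _ fun k _ => (hF k x).2)
  · exact iSup_congr fun n => min_eq_left (Finset.le_inf' _ _ fun k _ => h n k)
  · exact iInf_congr fun n => max_eq_left (Finset.sup'_le _ _ fun k _ => h k n)

theorem SetValuedUsc.isOpen_setOf_subset {X : Type*} [TopologicalSpace X] {T : X → Set ℝ}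
    (hT : SetValuedUsc T) {V : Set ℝ} (hV : IsOpen V) : IsOpen {x | T x ⊆ V} :=
  isOpen_iff_forall_mem_open.2 fun x hx =>
    let ⟨U, hU, hxU, h⟩ := hT x V hV hx
    ⟨U, h, hU, hxU⟩

open Set in
theorem SetValuedUsc.lowerSemicontinuous_sInf {X : Type*} [TopologicalSpace X] {T : X → Set ℝ}
    (hT : SetValuedUsc T) (hTc : ∀ x, IsCompact (T x)) (hTne : ∀ x, (T x).Nonempty) :
    LowerSemicontinuous fun x => sInf (T x) := by
  refine lowerSemicontinuous_iff_isOpen_preimage.2 fun c => ?_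
  convert hT.isOpen_setOf_subset (isOpen_Ioi (a := c)) using 1
  ext x
  exact ⟨fun h y hy => h.trans_le (csInf_le (hTc x).bddBelow hy),
    fun h => h ((hTc x).sInf_mem (hTne x))⟩

open Set in
theorem SetValuedUsc.upperSemicontinuous_sSup {X : Type*} [TopologicalSpace X] {T : X → Set ℝ}
    (hT : SetValuedUsc T) (hTc : ∀ x, IsCompact (T x)) (hTne : ∀ x, (T x).Nonempty) :
    UpperSemicontinuous fun x => sSup (T x) := by
  refine upperSemicontinuous_iff_isOpen_preimage.2 fun c => ?_
  convert hT.isOpen_setOf_subset (isOpen_Iio (a := c)) using 1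
  ext x
  exact ⟨fun h y hy => (le_csSup (hTc x).bddAbove hy).trans_lt h,
    fun h => h ((hTc x).sSup_mem (hTne x))⟩

open Set in
theorem setValuedUsc_Icc {X : Type*} [TopologicalSpace X] {f g : X → ℝ}
    (hf : LowerSemicontinuous f) (hg : UpperSemicontinuous g) (hfg : ∀ x, f x ≤ g x) :
    SetValuedUsc fun x => Icc (f x) (g x) := by
  intro x V hV hxV
  obtain ⟨ε, hε, hεV⟩ := Metric.isOpen_iff.1 hV (f x) (hxV (left_mem_Icc.2 (hfg x)))
  obtain ⟨δ, hδ, hδV⟩ := Metric.isOpen_iff.1 hV (g x) (hxV (right_mem_Icc.2 (hfg x)))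
  refine ⟨f ⁻¹' Ioi (f x - ε) ∩ g ⁻¹' Iio (g x + δ),
    (hf.isOpen_preimage _).inter (hg.isOpen_preimage _), ⟨by simpa, by simpa⟩, ?_⟩
  rintro z ⟨hz, hz'⟩ y ⟨hy, hy'⟩
  simp only [mem_preimage, mem_Ioi, mem_Iio] at hz hz'
  rcases lt_or_ge y (f x) with h | h
  · exact hεV (by rw [Real.ball_eq_Ioo]; constructor <;> linarith)
  rcases lt_or_ge (g x) y with h' | h'
  · exact hδV (by rw [Real.ball_eq_Ioo]; constructor <;> linarith)
  · exact hxV ⟨h, h'⟩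

/-- Extension of usc set-valued maps with nonempty closed convex
values in `[0,1]` from a closed, perfectly normal subset of a normal Hausdorff space. -/
theorem usc_extension_of_normal_of_perfectlyNormal_subset
    {X : Type*} [TopologicalSpace X] [T2Space X] [NormalSpace X]
    {A : Set X} (hA : IsClosed A) [T6Space A] (T : A → Set ℝ)
    (hTusc : SetValuedUsc T)
    (hTsub : ∀ a, T a ⊆ Set.Icc (0 : ℝ) 1)
    (hTne : ∀ a, (T a).Nonempty)
    (hTcl : ∀ a, IsClosed (T a))
    (hTconv : ∀ a, Convex ℝ (T a)) :
    ∃ T' : X → Set ℝ, SetValuedUsc T' ∧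
      (∀ x, T' x ⊆ Set.Icc (0 : ℝ) 1) ∧
      (∀ x, (T' x).Nonempty) ∧
      (∀ x, IsClosed (T' x)) ∧
      (∀ x, Convex ℝ (T' x)) ∧
      (∀ a : A, T' (a : X) = T a) := by
  have hTc (a : A) : IsCompact (T a) := isCompact_Icc.of_isClosed_subset (hTcl a) (hTsub a)
  have hT_Icc (a : A) : T a = Set.Icc (sInf (T a)) (sSup (T a)) :=
    eq_Icc_of_connected_compact ⟨hTne a, (hTconv a).isPreconnected⟩ (hTc a)
  have hInf (a : A) : sInf (T a) ∈ Set.Icc (0 : ℝ) 1 := hTsub a ((hTc a).sInf_mem (hTne a))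
  have hSup (a : A) : sSup (T a) ∈ Set.Icc (0 : ℝ) 1 := hTsub a ((hTc a).sSup_mem (hTne a))
  obtain ⟨F, hF01, hF⟩ := (hTusc.lowerSemicontinuous_sInf hTc hTne
    ).exists_seq_continuous_isLUB_of_isClosed hA hInf
  have hlsc : LowerSemicontinuous fun a => 1 - sSup (T a) := by
    refine lowerSemicontinuous_iff_isOpen_preimage.2 fun c => ?_
    convert (hTusc.upperSemicontinuous_sSup hTc hTne).isOpen_preimage (1 - c) using 1
    ext a
    simp [lt_sub_comm]
  obtain ⟨H, hH01, hH⟩ := hlsc.exists_seq_continuous_isLUB_of_isClosed hA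
    fun a => ⟨sub_nonneg.2 (hSup a).2, sub_le_self _ (hSup a).1⟩
  have hG (a : A) : IsGLB (Set.range fun n => (1 - H n) (a : X)) (sSup (T a)) := by
    refine ⟨?_, fun b hb => ?_⟩
    · rintro _ ⟨n, rfl⟩
      exact le_sub_comm.1 ((hH a).1 ⟨n, rfl⟩)
    · refine (sub_le_sub_iff_left (1 : ℝ)).1 ((hH a).2 ?_)
      rintro _ ⟨n, rfl⟩
      exact le_sub_comm.1 (hb ⟨n, rfl⟩)
  obtain ⟨f, g, hf, hg, hfg, hf0, hg1, hfg_eq⟩ :=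
    exists_lowerSemicontinuous_le_upperSemicontinuous (F := F) (G := fun n => 1 - H n) hF01
      fun n x => ⟨sub_nonneg.2 (hH01 n x).2, sub_le_self _ (hH01 n x).1⟩
  refine ⟨fun x => Set.Icc (f x) (g x), setValuedUsc_Icc hf hg hfg,
    fun x => Set.Icc_subset_Icc (hf0 x) (hg1 x), fun x => Set.nonempty_Icc.2 (hfg x),
    fun x => isClosed_Icc, fun x => convex_Icc _ _, fun a => ?_⟩
  have hle (m n : ℕ) : F m a ≤ (1 - H n) (a : X) :=
    ((hF a).1 ⟨m, rfl⟩).trans ((csInf_le_csSup (hTne a) (hTc a).bddBelow (hTc a).bddAbove).trans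
      ((hG a).1 ⟨n, rfl⟩))
  obtain ⟨hfa, hga⟩ := hfg_eq a hle
  rw [hT_Icc a, ← (hF a).ciSup_eq, ← (hG a).ciInf_eq, ← hfa, ← hga]
end

section
/- Let X be a Hausdorff topological space, A a closed subset of X, and T : A → [0,1] an upper semicontinuous set-valued map with nonempty closed convex values. Let B denote the set of dyadic rationals in [0,1], for r ∈ B let A_r = {x ∈ A : ∃ y ∈ T(x), y ≤ r}, and suppose (X_r)_{r∈B} is a family of closed subsets of X with X_1 = X satisfying: X_r ∩ A = A_r; int_A(A_r) ⊆ int_X(X_r); and X_r ⊆ X_s for r < s in B. Define F : X → [0,1] by F(x) = T(x) if x ∈ A, and F(x) = {inf{r ∈ B : x ∈ X_r}} otherwise. Then F is upper semicontinuous at every point of A (with respect to the topology of X). -/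
/-- The set of dyadic rationals in `[0,1]`: numbers of the form `i / 2 ^ n`. -/
def DyadicUnit : Set ℝ := {r | ∃ n i : ℕ, i ≤ 2 ^ n ∧ r = (i : ℝ) / 2 ^ n}

theorem exists_mem_dyadicUnit_between {x y : ℝ} (hx : 0 ≤ x) (hxy : x < y) (hy : y ≤ 1) :
    ∃ r ∈ DyadicUnit, x < r ∧ r < y := by
  obtain ⟨n, hn⟩ := exists_pow_lt_of_lt_one (sub_pos.2 hxy) (show (1 / 2 : ℝ) < 1 by norm_num)
  have hp : (0 : ℝ) < 2 ^ n := by positivity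
  have hn' : 1 < (y - x) * 2 ^ n := by
    rwa [one_div_pow, div_lt_iff₀ hp] at hn
  have h1 : (⌊x * 2 ^ n⌋₊ : ℝ) ≤ x * 2 ^ n := Nat.floor_le (by positivity)
  have h2 : x * 2 ^ n < ⌊x * 2 ^ n⌋₊ + 1 := Nat.lt_floor_add_one _
  have h3 : ((⌊x * 2 ^ n⌋₊ + 1 : ℕ) : ℝ) < y * 2 ^ n := by
    push_cast
    linarith
  refine ⟨_, ⟨n, ⌊x * 2 ^ n⌋₊ + 1, ?_, rfl⟩, ?_, ?_⟩
  · have h4 : ((⌊x * 2 ^ n⌋₊ + 1 : ℕ) : ℝ) ≤ 2 ^ n :=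
      h3.le.trans (mul_le_of_le_one_left hp.le hy)
    exact_mod_cast h4
  · rw [lt_div_iff₀ hp]
    exact_mod_cast h2
  · rwa [div_lt_iff₀ hp]

theorem nonneg_of_mem_dyadicUnit {r : ℝ} (hr : r ∈ DyadicUnit) : 0 ≤ r := by
  obtain ⟨n, i, -, rfl⟩ := hr
  positivity

theorem one_mem_dyadicUnit : (1 : ℝ) ∈ DyadicUnit := ⟨0, 1, by simp, by simp⟩

theorem csInf_dyadicUnit_le {X : Type*} {Xr : ℝ → Set X} {x : X} {r : ℝ}
    (hr : r ∈ DyadicUnit) (hx : x ∈ Xr r) : sInf {r ∈ DyadicUnit | x ∈ Xr r} ≤ r :=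
  csInf_le ⟨0, fun _ hs => nonneg_of_mem_dyadicUnit hs.1⟩ ⟨hr, hx⟩

/-- Given a usc map `T : A → [0,1]` with nonempty closed convex
values on a closed subset `A` of a Hausdorff space `X`, and a family `(X_r)` of
closed subsets of `X` indexed by the dyadic rationals with `X_1 = X`,
`X_r ∩ A = A_r := {x ∈ A : ∃ y ∈ T x, y ≤ r}`, `int_A(A_r) ⊆ int_X(X_r)` and
`X_r ⊆ X_s` for `r < s`, the map `F` equal to `T` on `A` and to
`{inf {r : x ∈ X_r}}` off `A` is usc at every point of `A`. -/
theorem F_usc_on_A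
    {X : Type*} [TopologicalSpace X] [T2Space X]
    {A : Set X} (hA : IsClosed A)
    (T : A → Set ℝ)
    (hTusc : SetValuedUsc T)
    (hTsub : ∀ a, T a ⊆ Set.Icc (0 : ℝ) 1)
    (hTne : ∀ a, (T a).Nonempty)
    (hTcl : ∀ a, IsClosed (T a))
    (hTconv : ∀ a, Convex ℝ (T a))
    (Xr : ℝ → Set X)
    (hXrcl : ∀ r ∈ DyadicUnit, IsClosed (Xr r))
    (hXr1 : Xr 1 = Set.univ)
    (hXrA : ∀ r ∈ DyadicUnit,
      Xr r ∩ A = Subtype.val '' {a : A | ∃ y ∈ T a, y ≤ r})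
    (hXrint : ∀ r ∈ DyadicUnit,
      Subtype.val '' interior {a : A | ∃ y ∈ T a, y ≤ r} ⊆ interior (Xr r))
    (hXrmono : ∀ r ∈ DyadicUnit, ∀ s ∈ DyadicUnit, r < s → Xr r ⊆ Xr s)
    (F : X → Set ℝ)
    (hFA : ∀ a : A, F (a : X) = T a)
    (hFnA : ∀ x : X, x ∉ A → F x = {sInf {r ∈ DyadicUnit | x ∈ Xr r}}) :
    ∀ a : A, SetValuedUscAt F (a : X) := by
  intro a V hV haV
  rw [hFA] at haV
  have hcpt : IsCompact (T a) := isCompact_Icc.of_isClosed_subset (hTcl a) (hTsub a)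
  obtain ⟨m, hm, hmle⟩ := hcpt.exists_isLeast (hTne a)
  obtain ⟨M, hM, hMge⟩ := hcpt.exists_isGreatest (hTne a)
  obtain ⟨δ, hδ, hmV⟩ := Metric.isOpen_iff.1 hV m (haV hm)
  obtain ⟨ε, hε, hMV⟩ := Metric.isOpen_iff.1 hV M (haV hM)
  have hne (x : X) : {r ∈ DyadicUnit | x ∈ Xr r}.Nonempty :=
    ⟨1, one_mem_dyadicUnit, hXr1 ▸ Set.mem_univ x⟩
  have hlow : ∀ᶠ x in nhds (a : X), m - δ < sInf {r ∈ DyadicUnit | x ∈ Xr r} := by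
    rcases (hTsub a hm).1.eq_or_lt with h0 | h0
    · refine Filter.Eventually.of_forall fun x => ?_
      have := le_csInf (hne x) fun s hs => nonneg_of_mem_dyadicUnit hs.1
      linarith
    · obtain ⟨r, hr, hlr, hrm⟩ := exists_mem_dyadicUnit_between (le_max_right (m - δ) 0)
        (max_lt (by linarith) h0) (hTsub a hm).2
      have har : (a : X) ∉ Xr r := by
        intro h
        have h' : (a : X) ∈ Xr r ∩ A := ⟨h, a.2⟩
        rw [hXrA r hr] at h'
        obtain ⟨b, ⟨y, hy, hyr⟩, hb⟩ := h'
        rw [Subtype.val_injective hb] at hy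
        linarith [hmle hy]
      filter_upwards [(hXrcl r hr).isOpen_compl.mem_nhds har] with x hx
      refine ((le_max_left _ _).trans_lt hlr).trans_le (le_csInf (hne x) fun s hs => ?_)
      by_contra! hsr
      exact hx (hXrmono s hs.1 r hr hsr hs.2)
  have hupp : ∀ᶠ x in nhds (a : X), sInf {r ∈ DyadicUnit | x ∈ Xr r} < M + ε := by
    rcases (hTsub a hM).2.eq_or_lt with h1 | h1
    · refine Filter.Eventually.of_forall fun x => ?_
      have : sInf {r ∈ DyadicUnit | x ∈ Xr r} ≤ 1 :=
        csInf_dyadicUnit_le one_mem_dyadicUnit (hXr1 ▸ Set.mem_univ x)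
      linarith
    · obtain ⟨r, hr, hMr, hru⟩ := exists_mem_dyadicUnit_between (hTsub a hM).1
        (lt_min (by linarith : M < M + ε) h1) (min_le_right _ _)
      obtain ⟨U, hU, haU, hUr⟩ := hTusc a (Set.Iio r) isOpen_Iio
        fun y hy => (hMge hy).trans_lt hMr
      have hint : a ∈ interior {a : A | ∃ y ∈ T a, y ≤ r} := by
        refine mem_interior.2 ⟨U, fun b hb => ?_, hU, haU⟩
        obtain ⟨y, hy⟩ := hTne b
        exact ⟨y, hy, le_of_lt (hUr b hb hy)⟩
      filter_upwards [mem_interior_iff_mem_nhds.1 (hXrint r hr ⟨a, hint, rfl⟩)] with x hx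
      exact (csInf_dyadicUnit_le hr hx).trans_lt (hru.trans_le (min_le_left _ _))
  have hon : ∀ᶠ x in nhds (a : X), ∀ hx : x ∈ A, T ⟨x, hx⟩ ⊆ V := by
    obtain ⟨U, hU, haU, hUV⟩ := hTusc a V hV haV
    obtain ⟨W, hW, rfl⟩ := isOpen_induced_iff.1 hU
    filter_upwards [hW.mem_nhds haU] with x hx hxA using hUV ⟨x, hxA⟩ hx
  have hF : ∀ᶠ x in nhds (a : X), F x ⊆ V := by
    filter_upwards [hlow, hupp, hon] with x hl hu hx
    by_cases hxA : x ∈ A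
    · exact hFA ⟨x, hxA⟩ ▸ hx hxA
    · rw [hFnA x hxA, Set.singleton_subset_iff]
      rcases lt_or_ge (sInf {r ∈ DyadicUnit | x ∈ Xr r}) m with h | h
      · exact hmV (by rw [Real.ball_eq_Ioo]; exact ⟨hl, by linarith⟩)
      rcases lt_or_ge M (sInf {r ∈ DyadicUnit | x ∈ Xr r}) with h' | h'
      · exact hMV (by rw [Real.ball_eq_Ioo]; exact ⟨by linarith, hu⟩)
      · exact haV ((hTconv a).ordConnected.out hm hM ⟨h, h'⟩)
  obtain ⟨U, hUV, hU, haU⟩ := eventually_nhds_iff.1 hF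
  exact ⟨U, hU, haU, hUV⟩
end
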